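/- Let A be a finite set of linearly independent vectors in ℤ^n. Then the number of points of ℤ^n lying in the relatively open parallelepiped {Σ_{a∈A} t_a a : 0 < t_a < 1 for all a ∈ A} equals Σ_{B ⊆ A} (−1)^{|A|−|B|} m(B). -/

import Mathlib

/-- The multiplicity of a finite family `v` of integer vectors restricted to `B`: the
cardinality of the torsion subgroup of `ℤ^n / ⟨B⟩`, i.e. the index `[Λ_B : ⟨B⟩]`. -/
noncomputable def mult {n : ℕ} {ι : Type} [Fintype ι] (v : ι → Fin n → ℤ) (B : Finset ι) : ℕ :=
  Nat.card (Submodule.torsion ℤ ((Fin n → ℤ) ⧸ Submodule.span ℤ (v '' ↑B)))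

/-- The integer points `∑ t i • v i` with `t i ∈ [0, 1)` and `t` supported on `B`. -/
def halfOpenPoints {n : ℕ} {ι : Type} [Fintype ι] (v : ι → Fin n → ℤ) (B : Finset ι) :
    Set (Fin n → ℤ) :=
  {x | ∃ t : ι → ℝ, (∀ i, t i ∈ Set.Ico (0 : ℝ) 1) ∧ (∀ i ∉ B, t i = 0) ∧
    ∀ j, (x j : ℝ) = ∑ i, t i * (v i j : ℝ)}

lemma mk_mem_torsion_iff {n : ℕ} {ι : Type} {v : ι → Fin n → ℤ} {B : Finset ι}
    {x : Fin n → ℤ} :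
    (Submodule.span ℤ (v '' ↑B)).mkQ x ∈
        Submodule.torsion ℤ ((Fin n → ℤ) ⧸ Submodule.span ℤ (v '' ↑B)) ↔
      ∃ k : ℤ, k ≠ 0 ∧ k • x ∈ Submodule.span ℤ (v '' ↑B) := by
  rw [Submodule.mem_torsion_iff]
  constructor
  · rintro ⟨a, ha⟩
    refine ⟨a, nonZeroDivisors.coe_ne_zero a, ?_⟩
    rw [← Submodule.Quotient.mk_eq_zero]
    exact ha
  · rintro ⟨k, hk, h⟩
    refine ⟨⟨k, mem_nonZeroDivisors_of_ne_zero hk⟩, ?_⟩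
    rw [← Submodule.Quotient.mk_eq_zero] at h
    exact h

section

variable {n : ℕ} {ι : Type} [Fintype ι] {v : ι → Fin n → ℤ}

lemma coeff_unique (hind : LinearIndependent ℝ (fun i (j : Fin n) => (v i j : ℝ)))
    {s t : ι → ℝ} (h : ∀ j, ∑ i, s i * (v i j : ℝ) = ∑ i, t i * (v i j : ℝ)) : s = t := by
  have h0 := Fintype.linearIndependent_iff.1 hind (fun i => s i - t i) (by
    ext j
    simp [sub_mul, h j])
  funext i
  linarith [h0 i]

lemma mem_span_image_iff_exists_int {B : Finset ι} {y : Fin n → ℤ} :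
    y ∈ Submodule.span ℤ (v '' ↑B) ↔
      ∃ c : ι → ℤ, (∀ i ∉ B, c i = 0) ∧ ∀ j, y j = ∑ i, c i * v i j := by
  classical
  constructor
  · intro h
    induction h using Submodule.span_induction with
    | mem x hx =>
      obtain ⟨i, hi, rfl⟩ := hx
      refine ⟨Pi.single i 1, fun k hk => ?_, fun j => ?_⟩
      · exact Pi.single_eq_of_ne (by rintro rfl; exact hk hi) _
      · simp [Pi.single_apply]
    | zero => exact ⟨0, by simp, by simp⟩
    | add x y _ _ hx hy =>
      obtain ⟨c, hc, hcx⟩ := hx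
      obtain ⟨d, hd, hdy⟩ := hy
      exact ⟨c + d, fun i hi => by simp [hc i hi, hd i hi], fun j => by
        simp [hcx, hdy, add_mul, Finset.sum_add_distrib]⟩
    | smul a x _ hx =>
      obtain ⟨c, hc, hcx⟩ := hx
      exact ⟨a • c, fun i hi => by simp [hc i hi], fun j => by
        simp [hcx, Finset.mul_sum, mul_assoc]⟩
  · rintro ⟨c, hc, hy⟩
    have : y = ∑ i, c i • v i := by
      ext j
      simp [hy]
    rw [this]
    refine Submodule.sum_mem _ fun i _ => ?_
    by_cases hi : i ∈ B
    · exact Submodule.smul_mem _ _ (Submodule.subset_span ⟨i, hi, rfl⟩)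
    · simp [hc i hi]

lemma halfOpenPoints_finite (v : ι → Fin n → ℤ) (B : Finset ι) :
    (halfOpenPoints v B).Finite := by
  refine (Set.finite_Icc (fun j => -∑ i, |v i j|) (fun j => ∑ i, |v i j|)).subset ?_
  rintro x ⟨t, ht, -, hx⟩
  have key : ∀ j, |x j| ≤ ∑ i, |v i j| := by
    intro j
    have : |(x j : ℝ)| ≤ ∑ i, |(v i j : ℝ)| := by
      rw [hx j]
      refine (Finset.abs_sum_le_sum_abs _ _).trans (Finset.sum_le_sum fun i _ => ?_)
      rw [abs_mul, abs_of_nonneg (ht i).1]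
      exact mul_le_of_le_one_left (abs_nonneg _) (ht i).2.le
    exact_mod_cast this
  exact ⟨fun j => (abs_le.1 (key j)).1, fun j => (abs_le.1 (key j)).2⟩

lemma sub_floor_mem_halfOpenPoints {B : Finset ι} {y : Fin n → ℤ} {s : ι → ℝ}
    (hs : ∀ i ∉ B, s i = 0) (hy : ∀ j, (y j : ℝ) = ∑ i, s i * (v i j : ℝ)) :
    (fun j => y j - ∑ i, ⌊s i⌋ * v i j) ∈ halfOpenPoints v B := by
  refine ⟨fun i => Int.fract (s i), fun i => ⟨Int.fract_nonneg _, Int.fract_lt_one _⟩,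
    fun i hi => by simp [hs i hi], fun j => ?_⟩
  push_cast
  rw [hy j, ← Finset.sum_sub_distrib]
  refine Finset.sum_congr rfl fun i _ => ?_
  rw [← Int.self_sub_floor]
  ring

lemma sum_floor_mem_span {B : Finset ι} {s : ι → ℝ} (hs : ∀ i ∉ B, s i = 0) :
    (fun j => ∑ i, ⌊s i⌋ * v i j) ∈ Submodule.span ℤ (v '' ↑B) :=
  mem_span_image_iff_exists_int.2 ⟨fun i => ⌊s i⌋, fun i hi => by simp [hs i hi], fun _ => rfl⟩

lemma mk_mem_torsion_of_mem_halfOpenPoints {B : Finset ι} {x : Fin n → ℤ}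
    (hx : x ∈ halfOpenPoints v B) :
    (Submodule.span ℤ (v '' ↑B)).mkQ x ∈
      Submodule.torsion ℤ ((Fin n → ℤ) ⧸ Submodule.span ℤ (v '' ↑B)) := by
  obtain ⟨t, -, htB, htx⟩ := hx
  have hs : ∀ k : ℕ, ∀ i ∉ B, (k : ℝ) * t i = 0 := fun k i hi => by simp [htB i hi]
  have hf : ∀ k : ℕ, (fun j => (k • x) j - ∑ i, ⌊(k : ℝ) * t i⌋ * v i j) ∈
      halfOpenPoints v B := fun k => sub_floor_mem_halfOpenPoints (hs k) fun j => by
    simp [htx, Finset.mul_sum, mul_assoc]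
  have := (halfOpenPoints_finite v B).to_subtype
  obtain ⟨k, l, hkl, h⟩ := Finite.exists_ne_map_eq_of_infinite
    (fun k : ℕ => (⟨_, hf k⟩ : halfOpenPoints v B))
  refine mk_mem_torsion_iff.2 ⟨(k : ℤ) - l, sub_ne_zero.2 (by exact_mod_cast hkl), ?_⟩
  convert Submodule.sub_mem _ (sum_floor_mem_span (v := v) (hs k))
    (sum_floor_mem_span (v := v) (hs l)) using 1
  ext j
  have hj := congrFun (Subtype.ext_iff.1 h) j
  simp only [Pi.smul_apply, nsmul_eq_mul, Pi.sub_apply, smul_eq_mul] at hj ⊢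
  linarith

/-- The multiplicity counts the integer points of the half-open parallelepiped. -/
lemma card_halfOpenPoints_eq_mult
    (hind : LinearIndependent ℝ (fun i (j : Fin n) => (v i j : ℝ))) (B : Finset ι) :
    Nat.card (halfOpenPoints v B) = mult v B := by
  refine Nat.card_congr (Equiv.ofBijective
    (fun x => ⟨_, mk_mem_torsion_of_mem_halfOpenPoints x.2⟩) ⟨?_, ?_⟩)
  · rintro ⟨x, t, ht, htB, htx⟩ ⟨y, s, hs, hsB, hsy⟩ h
    have h' : x - y ∈ Submodule.span ℤ (v '' ↑B) :=
      (Submodule.Quotient.eq _).1 (Subtype.ext_iff.1 h)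
    obtain ⟨c, -, hc⟩ := mem_span_image_iff_exists_int.1 h'
    have hts : (fun i => t i - s i) = fun i => (c i : ℝ) := coeff_unique hind fun j => by
      have hj : (x j : ℝ) - y j = ∑ i, (c i : ℝ) * v i j := by exact_mod_cast hc j
      simp only [sub_mul, Finset.sum_sub_distrib]
      rw [← htx, ← hsy, hj]
    have hc0 : ∀ i, c i = 0 := fun i => by
      have hi := congrFun hts i
      have h1 : (c i : ℝ) < 1 := by linarith [(ht i).2, (hs i).1]
      have h2 : (-1 : ℝ) < c i := by linarith [(ht i).1, (hs i).2]
      have h1' : c i < 1 := by exact_mod_cast h1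
      have h2' : -1 < c i := by exact_mod_cast h2
      omega
    refine Subtype.ext (funext fun j => ?_)
    have hj := hc j
    simp only [hc0, Pi.sub_apply, zero_mul, Finset.sum_const_zero] at hj
    exact sub_eq_zero.1 hj
  · rintro ⟨q, hq⟩
    obtain ⟨y, rfl⟩ := Submodule.mkQ_surjective _ q
    obtain ⟨k, hk, hky⟩ := mk_mem_torsion_iff.1 hq
    obtain ⟨c, hc, hcy⟩ := mem_span_image_iff_exists_int.1 hky
    have hs : ∀ i ∉ B, (c i : ℝ) / k = 0 := fun i hi => by simp [hc i hi]
    have hkR : (k : ℝ) ≠ 0 := by exact_mod_cast hk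
    refine ⟨⟨_, sub_floor_mem_halfOpenPoints (y := y) hs fun j => ?_⟩, ?_⟩
    · have hj : (k : ℝ) * y j = ∑ i, (c i : ℝ) * v i j := by exact_mod_cast hcy j
      apply mul_left_cancel₀ hkR
      rw [hj, Finset.mul_sum]
      refine Finset.sum_congr rfl fun i _ => ?_
      field_simp
    · refine Subtype.ext ((Submodule.Quotient.eq _).2 ?_)
      convert Submodule.neg_mem _ (sum_floor_mem_span (v := v) hs) using 1
      ext j
      simp

lemma sum_superset_neg_one_pow [DecidableEq ι] (S : Finset ι) :
    ∑ B : Finset ι, (if S ⊆ B then (-1 : ℤ) ^ (Fintype.card ι - B.card) else 0) =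
      if S = Finset.univ then 1 else 0 := by
  have h := Finset.sum_powerset_neg_one_pow_card (x := Sᶜ)
  simp only [Finset.compl_eq_empty_iff] at h
  rw [← h, ← Finset.sum_filter]
  refine Finset.sum_nbij' (fun B => Bᶜ) (fun B => Bᶜ) ?_ ?_ ?_ ?_ ?_
  · intro B hB
    simpa using hB
  · intro B hB
    simpa [Finset.subset_compl_comm] using hB
  · simp
  · simp
  · intro B _
    rw [Finset.card_compl]

end


/-- Let `A` be a finite set of linearly independent vectors in `ℤ^n`. The number of integer
points in the relatively open parallelepiped `{Σ_{a∈A} t_a a : 0 < t_a < 1}` equals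
`Σ_{B ⊆ A} (−1)^{|A|−|B|} m(B)`. -/
theorem stmt6 {n : ℕ} {ι : Type} [Fintype ι] (v : ι → Fin n → ℤ)
    (hind : LinearIndependent ℝ (fun i (j : Fin n) => (v i j : ℝ))) :
    (Nat.card {x : Fin n → ℤ | ∃ t : ι → ℝ,
        (∀ i, t i ∈ Set.Ioo (0 : ℝ) 1) ∧
        (fun j => (x j : ℝ)) = ∑ i, t i • (fun j => (v i j : ℝ))} : ℤ) =
      ∑ B : Finset ι, (-1 : ℤ) ^ (Fintype.card ι - B.card) * (mult v B : ℤ) := by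
  classical
  have hfin := halfOpenPoints_finite v Finset.univ
  have hcoeff : ∀ x : Fin n → ℤ, ∃ t : ι → ℝ, x ∈ halfOpenPoints v Finset.univ →
      (∀ i, t i ∈ Set.Ico (0 : ℝ) 1) ∧ ∀ j, (x j : ℝ) = ∑ i, t i * (v i j : ℝ) := fun x => by
    by_cases hx : x ∈ halfOpenPoints v Finset.univ
    · obtain ⟨t, ht, -, htx⟩ := hx
      exact ⟨t, fun _ => ⟨ht, htx⟩⟩
    · exact ⟨0, fun h => (hx h).elim⟩
  choose t ht using hcoeff
  let S : (Fin n → ℤ) → Finset ι := fun x => Finset.univ.filter fun i => t x i ≠ 0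
  have hB : ∀ B : Finset ι, mult v B = (hfin.toFinset.filter fun x => S x ⊆ B).card := fun B => by
    rw [← card_halfOpenPoints_eq_mult hind, ← Set.ncard_coe_finset]
    change Set.ncard _ = _
    congr 1
    ext x
    simp only [Finset.coe_filter, Set.Finite.mem_toFinset, Set.mem_ofPred_eq]
    constructor
    · rintro ⟨s, hs, hsB, hsx⟩
      have hx : x ∈ halfOpenPoints v Finset.univ := ⟨s, hs, by simp, hsx⟩
      have hst : s = t x := coeff_unique hind fun j => by rw [← hsx, ← (ht x hx).2]
      refine ⟨hx, fun i hi => ?_⟩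
      by_contra hiB
      exact (Finset.mem_filter.1 hi).2 (hst ▸ hsB i hiB)
    · rintro ⟨hx, hSB⟩
      refine ⟨t x, (ht x hx).1, fun i hi => ?_, (ht x hx).2⟩
      by_contra h
      exact hi (hSB (Finset.mem_filter.2 ⟨Finset.mem_univ _, h⟩))
  have hL : Nat.card {x : Fin n → ℤ | ∃ t : ι → ℝ, (∀ i, t i ∈ Set.Ioo (0 : ℝ) 1) ∧
      (fun j => (x j : ℝ)) = ∑ i, t i • (fun j => (v i j : ℝ))} =
      (hfin.toFinset.filter fun x => S x = Finset.univ).card := by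
    rw [← Set.ncard_coe_finset]
    change Set.ncard _ = _
    congr 1
    ext x
    simp only [Finset.coe_filter, Set.Finite.mem_toFinset, Set.mem_ofPred_eq]
    constructor
    · rintro ⟨s, hs, hsx⟩
      have hsx' : ∀ j, (x j : ℝ) = ∑ i, s i * (v i j : ℝ) := fun j => by
        simpa using congrFun hsx j
      have hx : x ∈ halfOpenPoints v Finset.univ :=
        ⟨s, fun i => ⟨(hs i).1.le, (hs i).2⟩, by simp, hsx'⟩
      have hst : s = t x := coeff_unique hind fun j => by rw [← hsx', ← (ht x hx).2]
      refine ⟨hx, Finset.filter_true_of_mem fun i _ => ?_⟩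
      rw [← hst]
      exact (hs i).1.ne'
    · rintro ⟨hx, hS⟩
      refine ⟨t x, fun i => ⟨((ht x hx).1 i).1.lt_of_ne' ?_, ((ht x hx).1 i).2⟩, ?_⟩
      · exact (Finset.mem_filter.1 (hS ▸ Finset.mem_univ i : i ∈ S x)).2
      · ext j
        simpa using (ht x hx).2 j
  rw [hL]
  simp only [hB, Finset.card_filter, Nat.cast_sum, Finset.mul_sum]
  rw [Finset.sum_comm]
  refine Finset.sum_congr rfl fun x _ => ?_
  push_cast
  rw [← sum_superset_neg_one_pow]
  simp
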